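/- arXiv:math/0204307 — 3 statements merged into one kernel-verified Lean document; each statement's English description precedes it below -/
import Mathlib

section
/- Let A be a commutative ring, B and A' be A-algebras with a surjection A' → A, let F be a functor from commutative rings to sets of quotient modules as in the Quot functor, i.e. for any ring C over A, Q(C) is the set of C-module quotients of M ⊗_A C (for a fixed A-module M). Then the natural map Q(A' ×_A B) → Q(A') ×_{Q(A)} Q(B) is a bijection. -/
open TensorProduct

variable {A : Type*} [CommRing A]

/-- The Quot "functor" of a fixed `A`-module `M`: for an `A`-algebra `C`, the set of
`C`-module quotients of `C ⊗_A M` which are flat over `C`, encoded by their kernels. -/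
def quotSet (A : Type*) [CommRing A] (M : Type*) [AddCommGroup M] [Module A M]
    (C : Type*) [CommRing C] [Algebra A C] : Set (Submodule C (C ⊗[A] M)) :=
  {K | Module.Flat C ((C ⊗[A] M) ⧸ K)}

/-- Functoriality of the Quot set: pushforward of a kernel along an `A`-algebra map
`f : C → D`, i.e. the kernel of the base-changed quotient. -/
noncomputable def quotMap {A : Type*} [CommRing A] (M : Type*) [AddCommGroup M] [Module A M]
    {C D : Type*} [CommRing C] [Algebra A C] [CommRing D] [Algebra A D] (f : C →ₐ[A] D)
    (K : Submodule C (C ⊗[A] M)) : Submodule D (D ⊗[A] M) :=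
  Submodule.span D ((TensorProduct.map f.toLinearMap (LinearMap.id : M →ₗ[A] M)) '' K)

section BaseChange
variable (A : Type*) [CommRing A] (M : Type*) [AddCommGroup M] [Module A M]
    (C D : Type*) [CommRing C] [Algebra A C] [CommRing D] [Algebra A D] [Algebra C D]
    [IsScalarTower A C D]

/-- the map on tensor products -/
noncomputable def gMap {A : Type*} [CommRing A] (M : Type*) [AddCommGroup M] [Module A M]
    {C D : Type*} [CommRing C] [Algebra A C] [CommRing D] [Algebra A D] (f : C →ₐ[A] D) :
    C ⊗[A] M →ₗ[A] D ⊗[A] M :=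
  TensorProduct.map f.toLinearMap (LinearMap.id : M →ₗ[A] M)

lemma gMap_tmul {A : Type*} [CommRing A] (M : Type*) [AddCommGroup M] [Module A M]
    {C D : Type*} [CommRing C] [Algebra A C] [CommRing D] [Algebra A D] (f : C →ₐ[A] D)
    (c : C) (m : M) : gMap M f (c ⊗ₜ m) = f c ⊗ₜ m := rfl

lemma gMap_smul {A : Type*} [CommRing A] (M : Type*) [AddCommGroup M] [Module A M]
    {C D : Type*} [CommRing C] [Algebra A C] [CommRing D] [Algebra A D] (f : C →ₐ[A] D)
    (c : C) (x : C ⊗[A] M) : gMap M f (c • x) = f c • gMap M f x := by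
  induction x with
  | zero => simp
  | add x y hx hy => simp [hx, hy]
  | tmul a m => simp [gMap_tmul, TensorProduct.smul_tmul']

lemma cancel_one_tmul (x : C ⊗[A] M) :
    AlgebraTensorModule.cancelBaseChange A C D D M (1 ⊗ₜ x) =
      gMap M (IsScalarTower.toAlgHom A C D) x := by
  induction x with
  | zero => simp
  | add x y hx hy => simp [TensorProduct.tmul_add, hx, hy]
  | tmul a m => simp [gMap_tmul, Algebra.smul_def]

/-- the presentation of the base-changed quotient -/
noncomputable def phi (K : Submodule C (C ⊗[A] M)) :
    D ⊗[A] M →ₗ[D] D ⊗[C] ((C ⊗[A] M) ⧸ K) :=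
  (K.mkQ.baseChange D) ∘ₗ (AlgebraTensorModule.cancelBaseChange A C D D M).symm.toLinearMap

lemma phi_gMap (K : Submodule C (C ⊗[A] M)) (x : C ⊗[A] M) :
    phi A M C D K (gMap M (IsScalarTower.toAlgHom A C D) x) = 1 ⊗ₜ K.mkQ x := by
  rw [← cancel_one_tmul]
  simp [phi]

lemma phi_surj (K : Submodule C (C ⊗[A] M)) : Function.Surjective (phi A M C D K) := by
  unfold phi
  rw [LinearMap.coe_comp]
  exact (LinearMap.lTensor_surjective D (Submodule.mkQ_surjective K)).comp
    (AlgebraTensorModule.cancelBaseChange A C D D M).symm.surjective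

lemma ker_phi (K : Submodule C (C ⊗[A] M)) :
    LinearMap.ker (phi A M C D K) = quotMap M (IsScalarTower.toAlgHom A C D) K := by
  apply le_antisymm
  · intro x hx
    rw [LinearMap.mem_ker] at hx
    have hex := lTensor_exact D (M := K) (f := K.subtype) (LinearMap.exact_subtype_mkQ K) (Submodule.mkQ_surjective K)
    obtain ⟨y, hy⟩ := (hex _).1 hx
    have hx' : x = AlgebraTensorModule.cancelBaseChange A C D D M (K.subtype.lTensor D y) := by
      rw [hy]; simp
    rw [hx']
    clear hx' hy hx
    induction y with
    | zero => simp
    | add x y hx hy => rw [map_add, map_add]; exact Submodule.add_mem _ hx hy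
    | tmul d k =>
      have : (K.subtype.lTensor D (d ⊗ₜ k)) = d • ((1 : D) ⊗ₜ[C] (k : C ⊗[A] M)) := by
        simp [TensorProduct.smul_tmul']
      rw [this, map_smul, cancel_one_tmul]
      exact Submodule.smul_mem _ _ (Submodule.subset_span ⟨k, k.2, rfl⟩)
  · refine Submodule.span_le.2 ?_
    rintro _ ⟨k, hk, rfl⟩
    have := phi_gMap A M C D K k
    rw [SetLike.mem_coe, LinearMap.mem_ker]
    refine this.trans ?_
    rw [Submodule.mkQ_apply, (Submodule.Quotient.mk_eq_zero K).2 hk, TensorProduct.tmul_zero]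

/-- base change of the quotient -/
noncomputable def quotEquiv (K : Submodule C (C ⊗[A] M)) :
    ((D ⊗[A] M) ⧸ quotMap M (IsScalarTower.toAlgHom A C D) K) ≃ₗ[D]
      D ⊗[C] ((C ⊗[A] M) ⧸ K) :=
  (Submodule.quotEquivOfEq _ _ (ker_phi A M C D K).symm).trans
    ((phi A M C D K).quotKerEquivOfSurjective (phi_surj A M C D K))

lemma flat_iff (K : Submodule C (C ⊗[A] M)) :
    quotMap M (IsScalarTower.toAlgHom A C D) K ∈ quotSet A M D ↔
      Module.Flat D (D ⊗[C] ((C ⊗[A] M) ⧸ K)) :=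
  Module.Flat.equiv_iff (quotEquiv A M C D K)

end BaseChange

section Flat
variable {P N : Type*} [CommRing P] [AddCommGroup N] [Module P N]

lemma key_inj (S : Type*) [CommRing S] [Algebra P S] [Module.Flat S (S ⊗[P] N)] (b : Ideal S) :
    Function.Injective ((b.subtype.restrictScalars P).rTensor N) := by
  have h1 : Function.Injective (b.subtype.rTensor (S ⊗[P] N)) :=
    Module.Flat.rTensor_preserves_injective_linearMap _ Subtype.val_injective
  have h2 : ∀ x, (b.subtype.restrictScalars P).rTensor N
      (AlgebraTensorModule.cancelBaseChange P S S b N x) =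
      AlgebraTensorModule.cancelBaseChange P S S S N (b.subtype.rTensor (S ⊗[P] N) x) := by
    intro x
    induction x with
    | zero => simp
    | add x y hx hy => simp [hx, hy]
    | tmul u v =>
      induction v with
      | zero => simp
      | add x y hx hy => simp only [TensorProduct.tmul_add, map_add, hx, hy]
      | tmul s n => simp
  intro x y hxy
  obtain ⟨x, rfl⟩ := (AlgebraTensorModule.cancelBaseChange P S S b N).surjective x
  obtain ⟨y, rfl⟩ := (AlgebraTensorModule.cancelBaseChange P S S b N).surjective y
  rw [h2, h2] at hxy
  rw [h1 ((AlgebraTensorModule.cancelBaseChange P S S S N).injective hxy)]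

/-- ideal to its image -/
def toMap (S : Type*) [CommRing S] [Algebra P S] (a : Ideal P) :
    a →ₗ[P] (a.map (algebraMap P S)) :=
  ((Algebra.linearMap P S).domRestrict a).codRestrict
    ((a.map (algebraMap P S)).restrictScalars P)
    (fun x => Ideal.mem_map_of_mem _ x.2)

lemma toMap_inj_tensor (S : Type*) [CommRing S] [Algebra P S] [Module.Flat S (S ⊗[P] N)]
    (a : Ideal P) (x : a ⊗[P] N) (hx : a.subtype.rTensor N x = 0) :
    (toMap S a).rTensor N x = 0 := by
  apply key_inj S (a.map (algebraMap P S))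
  rw [map_zero, ← LinearMap.comp_apply, ← LinearMap.rTensor_comp]
  have : ((a.map (algebraMap P S)).subtype.restrictScalars P) ∘ₗ toMap S a =
    Algebra.linearMap P S ∘ₗ a.subtype := rfl
  rw [this, LinearMap.rTensor_comp, LinearMap.comp_apply, hx, map_zero]

lemma toMap_surj (S : Type*) [CommRing S] [Algebra P S]
    (hS : Function.Surjective (algebraMap P S)) (a : Ideal P) :
    Function.Surjective (toMap S a) := by
  rintro ⟨y, hy⟩
  obtain ⟨x, hx, rfl⟩ := (Ideal.mem_map_iff_of_surjective _ hS).1 hy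
  exact ⟨⟨x, hx⟩, rfl⟩

lemma flat_of (S T : Type*) [CommRing S] [Algebra P S] [CommRing T] [Algebra P T]
    [Module.Flat S (S ⊗[P] N)] [Module.Flat T (T ⊗[P] N)]
    (hS : Function.Surjective (algebraMap P S)) (hT : Function.Surjective (algebraMap P T))
    (h : ∀ p : P, algebraMap P S p = 0 → algebraMap P T p = 0 → p = 0) :
    Module.Flat P N := by
  rw [Module.Flat.iff_rTensor_injective']
  intro a
  rw [injective_iff_map_eq_zero]
  intro x hx
  have h1 := toMap_inj_tensor S a x hx
  let c : Ideal P := a ⊓ RingHom.ker (algebraMap P S)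
  have hca : c ≤ a := inf_le_left
  have hex : Function.Exact (Submodule.inclusion hca) (toMap S a) := by
    intro y
    constructor
    · intro hy
      exact ⟨⟨y.1, y.2, congrArg Subtype.val hy⟩, rfl⟩
    · rintro ⟨z, rfl⟩
      exact Subtype.ext z.2.2
  obtain ⟨y, rfl⟩ := (rTensor_exact N hex (toMap_surj S hS a) x).1 h1
  have hy : c.subtype.rTensor N y = 0 := by
    rw [← LinearMap.comp_apply, ← LinearMap.rTensor_comp] at hx
    exact hx
  have h2 := toMap_inj_tensor T c y hy
  have hinj : Function.Injective (toMap T c) := by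
    rw [injective_iff_map_eq_zero]
    intro z hz
    exact Subtype.ext (h z.1 z.2.2 (congrArg Subtype.val hz))
  let e := LinearEquiv.ofBijective (toMap T c) ⟨hinj, toMap_surj T hT c⟩
  have : y = 0 := (e.rTensor N).injective (by rw [map_zero]; exact h2)
  rw [this, map_zero]

lemma eq_zero_of (S T : Type*) [CommRing S] [Algebra P S] [CommRing T] [Algebra P T]
    [Module.Flat P N]
    (h : ∀ p : P, algebraMap P S p = 0 → algebraMap P T p = 0 → p = 0) (n : N)
    (h1 : (1 : S) ⊗ₜ[P] n = 0) (h2 : (1 : T) ⊗ₜ[P] n = 0) : n = 0 := by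
  let f : P →ₗ[P] S × T := (Algebra.linearMap P S).prod (Algebra.linearMap P T)
  have hf : Function.Injective f := by
    rw [injective_iff_map_eq_zero]
    intro p hp
    exact h p (congrArg Prod.fst hp) (congrArg Prod.snd hp)
  have := Module.Flat.rTensor_preserves_injective_linearMap (M := N) f hf
  apply (TensorProduct.lid P N).symm.injective
  apply this
  apply (TensorProduct.prodLeft P P S T N).injective
  simp [f, h1, h2]

end Flat

section Main
variable {A : Type*} [CommRing A] {M : Type*} [AddCommGroup M] [Module A M]

lemma mem_quotMap {C D : Type*} [CommRing C] [Algebra A C] [CommRing D] [Algebra A D]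
    (f : C →ₐ[A] D) (hf : Function.Surjective f)
    (K : Submodule C (C ⊗[A] M)) (y : D ⊗[A] M) :
    y ∈ quotMap M f K ↔ ∃ x ∈ K, gMap M f x = y := by
  constructor
  · intro hy
    refine Submodule.span_induction (p := fun y _ => ∃ x ∈ K, gMap M f x = y) ?_ ?_ ?_ ?_ hy
    · rintro _ ⟨x, hx, rfl⟩
      exact ⟨x, hx, rfl⟩
    · exact ⟨0, K.zero_mem, map_zero _⟩
    · rintro _ _ _ _ ⟨x, hx, rfl⟩ ⟨y, hy, rfl⟩
      exact ⟨x + y, K.add_mem hx hy, map_add _ _ _⟩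
    · rintro d _ _ ⟨x, hx, rfl⟩
      obtain ⟨c, rfl⟩ := hf d
      exact ⟨c • x, K.smul_mem c hx, gMap_smul _ _ _ _⟩
  · rintro ⟨x, hx, rfl⟩
    exact Submodule.subset_span ⟨x, hx, rfl⟩

lemma gMap_comp {C D E : Type*} [CommRing C] [Algebra A C] [CommRing D] [Algebra A D]
    [CommRing E] [Algebra A E] (f : C →ₐ[A] D) (g : D →ₐ[A] E) (x : C ⊗[A] M) :
    gMap M g (gMap M f x) = gMap M (g.comp f) x := by
  induction x with
  | zero => simp
  | add x y hx hy => simp [hx, hy]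
  | tmul a m => simp [gMap_tmul]

lemma quotMap_comp {C D E : Type*} [CommRing C] [Algebra A C] [CommRing D] [Algebra A D]
    [CommRing E] [Algebra A E] (f : C →ₐ[A] D) (g : D →ₐ[A] E)
    (hf : Function.Surjective f) (hg : Function.Surjective g) (K : Submodule C (C ⊗[A] M)) :
    quotMap M g (quotMap M f K) = quotMap M (g.comp f) K := by
  ext y
  rw [mem_quotMap _ hg, mem_quotMap (g.comp f) (hg.comp hf)]
  constructor
  · rintro ⟨x, hx, rfl⟩
    obtain ⟨z, hz, rfl⟩ := (mem_quotMap _ hf _ _).1 hx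
    exact ⟨z, hz, (gMap_comp f g z).symm⟩
  · rintro ⟨z, hz, rfl⟩
    exact ⟨_, (mem_quotMap _ hf _ _).2 ⟨z, hz, rfl⟩, gMap_comp f g z⟩

lemma main_aux (P A' B : Type*) [CommRing P] [Algebra A P]
    [CommRing A'] [Algebra A A'] [CommRing B] [Algebra A B]
    (p : P →ₐ[A] A') (q : P →ₐ[A] B)
    (π : A' →ₐ[A] A) (ρ : B →ₐ[A] A)
    (hπ : Function.Surjective π) (hρ : Function.Surjective ρ)
    (hp : Function.Surjective p) (hq : Function.Surjective q)
    (hinj : ∀ x : P, p x = 0 → q x = 0 → x = 0)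
    (hc : π.comp p = ρ.comp q)
    (hex : ∀ a b, π a = ρ b → ∃ x, p x = a ∧ q x = b) :
    Set.BijOn
      (fun K : Submodule P (P ⊗[A] M) => (quotMap M p K, quotMap M q K))
      (quotSet A M P)
      {KK : Submodule A' (A' ⊗[A] M) × Submodule B (B ⊗[A] M) |
        KK.1 ∈ quotSet A M A' ∧ KK.2 ∈ quotSet A M B ∧
        quotMap M π KK.1 = quotMap M ρ KK.2} := by
  let : Algebra P A' := p.toRingHom.toAlgebra
  let : Algebra P B := q.toRingHom.toAlgebra
  have : IsScalarTower A P A' := IsScalarTower.of_algebraMap_eq' p.comp_algebraMap.symm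
  have : IsScalarTower A P B := IsScalarTower.of_algebraMap_eq' q.comp_algebraMap.symm
  have ep : IsScalarTower.toAlgHom A P A' = p := rfl
  have eq : IsScalarTower.toAlgHom A P B = q := rfl
  have hcomap : ∀ K ∈ quotSet A M P, ∀ x, gMap M p x ∈ quotMap M p K →
      gMap M q x ∈ quotMap M q K → x ∈ K := by
    intro K hK x h1 h2
    have : Module.Flat P ((P ⊗[A] M) ⧸ K) := hK
    rw [← Submodule.Quotient.mk_eq_zero]
    apply eq_zero_of A' B hinj
    · rw [← ep, ← ker_phi, LinearMap.mem_ker, phi_gMap] at h1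
      exact h1
    · rw [← eq, ← ker_phi, LinearMap.mem_ker, phi_gMap] at h2
      exact h2
  refine ⟨?_, ?_, ?_⟩
  · intro K hK
    have : Module.Flat P ((P ⊗[A] M) ⧸ K) := hK
    refine ⟨?_, ?_, ?_⟩
    · exact (flat_iff A M P A' K).2 inferInstance
    · exact (flat_iff A M P B K).2 inferInstance
    · show quotMap M π (quotMap M p K) = quotMap M ρ (quotMap M q K)
      rw [quotMap_comp p π hp hπ, quotMap_comp q ρ hq hρ, hc]
  · have key : ∀ K ∈ quotSet A M P, ∀ L ∈ quotSet A M P, quotMap M p K = quotMap M p L →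
        quotMap M q K = quotMap M q L → K ≤ L := by
      intro K _ L hL h1 h2 x hx
      apply hcomap L hL
      · rw [← h1]
        exact (mem_quotMap _ hp _ _).2 ⟨x, hx, rfl⟩
      · rw [← h2]
        exact (mem_quotMap _ hq _ _).2 ⟨x, hx, rfl⟩
    intro K hK L hL h
    have h1 := congrArg Prod.fst h
    have h2 := congrArg Prod.snd h
    exact le_antisymm (key K hK L hL h1 h2) (key L hL K hK h1.symm h2.symm)
  · rintro ⟨K1, K2⟩ ⟨hK1, hK2, h12⟩
    simp only at hK1 hK2 h12
    let K : Submodule P (P ⊗[A] M) :=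
      { carrier := {x | gMap M p x ∈ K1 ∧ gMap M q x ∈ K2}
        zero_mem' := by simp
        add_mem' := by
          rintro x y ⟨h1, h2⟩ ⟨h3, h4⟩
          exact ⟨by rw [map_add]; exact K1.add_mem h1 h3, by rw [map_add]; exact K2.add_mem h2 h4⟩
        smul_mem' := by
          rintro c x ⟨h1, h2⟩
          exact ⟨by rw [gMap_smul]; exact K1.smul_mem _ h1,
            by rw [gMap_smul]; exact K2.smul_mem _ h2⟩ }
    have lift : ∀ k1 k2, gMap M π k1 = gMap M ρ k2 → ∃ w, gMap M p w = k1 ∧ gMap M q w = k2 := by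
      intro k1 k2 hk
      let f : P →ₗ[A] A' × B := p.toLinearMap.prod q.toLinearMap
      let g : A' × B →ₗ[A] A := π.toLinearMap.coprod (-ρ.toLinearMap)
      have hfg : Function.Exact f g := by
        rintro ⟨a, b⟩
        constructor
        · intro h
          have h' : π a + -ρ b = 0 := h
          obtain ⟨x, h1, h2⟩ := hex a b (by rw [← sub_eq_zero, sub_eq_add_neg]; exact h')
          exact ⟨x, Prod.ext h1 h2⟩
        · rintro ⟨x, hx⟩
          have h1 : p x = a := congrArg Prod.fst hx
          have h2 : q x = b := congrArg Prod.snd hx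
          have h3 : π (p x) = ρ (q x) := DFunLike.congr_fun hc x
          show π a + -ρ b = 0
          rw [← h1, ← h2, h3, add_neg_cancel]
      have hg : Function.Surjective g := by
        intro a
        obtain ⟨a', rfl⟩ := hπ a
        exact ⟨(a', 0), by simp [g]⟩
      let z := (TensorProduct.prodLeft A A A' B M).symm (k1, k2)
      have h1 : ∀ z, g.rTensor M z = gMap M π (TensorProduct.prodLeft A A A' B M z).1 -
          gMap M ρ (TensorProduct.prodLeft A A A' B M z).2 := by
        intro z
        induction z with
        | zero => simp
        | add x y hx hy => simp only [map_add, hx, hy, Prod.fst_add, Prod.snd_add]; abel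
        | tmul s m =>
          obtain ⟨a, b⟩ := s
          simp [g, gMap_tmul, TensorProduct.add_tmul, TensorProduct.neg_tmul, sub_eq_add_neg]
      have h2 : ∀ w, TensorProduct.prodLeft A A A' B M (f.rTensor M w) =
          (gMap M p w, gMap M q w) := by
        intro w
        induction w with
        | zero => simp only [map_zero]; rfl
        | add x y hx hy => simp only [map_add, hx, hy, Prod.mk_add_mk]
        | tmul s m => simp [f, gMap_tmul]
      obtain ⟨w, hw⟩ := (rTensor_exact M hfg hg z).1 (by rw [h1]; simp [z, hk])
      have h3 := h2 w
      rw [hw] at h3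
      simp only [z, LinearEquiv.apply_symm_apply] at h3
      exact ⟨w, (congrArg Prod.fst h3).symm, (congrArg Prod.snd h3).symm⟩
    have e1 : quotMap M p K = K1 := by
      ext y
      rw [mem_quotMap p hp]
      constructor
      · rintro ⟨x, hx, rfl⟩
        exact hx.1
      · intro hy
        have := (mem_quotMap π hπ K1 _).2 ⟨y, hy, rfl⟩
        rw [h12] at this
        obtain ⟨k2, hk2, h⟩ := (mem_quotMap ρ hρ K2 _).1 this
        obtain ⟨w, hw1, hw2⟩ := lift y k2 h.symm
        exact ⟨w, ⟨by rw [hw1]; exact hy, by rw [hw2]; exact hk2⟩, hw1⟩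
    have e2 : quotMap M q K = K2 := by
      ext y
      rw [mem_quotMap q hq]
      constructor
      · rintro ⟨x, hx, rfl⟩
        exact hx.2
      · intro hy
        have := (mem_quotMap ρ hρ K2 _).2 ⟨y, hy, rfl⟩
        rw [← h12] at this
        obtain ⟨k1, hk1, h⟩ := (mem_quotMap π hπ K1 _).1 this
        obtain ⟨w, hw1, hw2⟩ := lift k1 y h
        exact ⟨w, ⟨by rw [hw1]; exact hk1, by rw [hw2]; exact hy⟩, hw2⟩
    refine ⟨K, ?_, Prod.ext e1 e2⟩
    have f1 : Module.Flat A' (A' ⊗[P] ((P ⊗[A] M) ⧸ K)) :=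
      (flat_iff A M P A' K).1 (by rw [ep, e1]; exact hK1)
    have f2 : Module.Flat B (B ⊗[P] ((P ⊗[A] M) ⧸ K)) :=
      (flat_iff A M P B K).1 (by rw [eq, e2]; exact hK2)
    exact flat_of A' B hp hq hinj

end Main

set_option synthInstance.maxHeartbeats 1000000 in
set_option maxHeartbeats 1000000 in
/-- Schlessinger-type homogeneity of the Quot functor: given `A`-algebra maps `π : A' → A`
(surjective) and `ρ : B → A`, with `P = A' ×_A B` the fiber product ring, the natural map
`Q(A' ×_A B) → Q(A') ×_{Q(A)} Q(B)` is a bijection. -/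
theorem stmt5 (A : Type*) [CommRing A] (M : Type*) [AddCommGroup M] [Module A M]
    (A' B : Type*) [CommRing A'] [Algebra A A'] [CommRing B] [Algebra A B]
    (π : A' →ₐ[A] A) (ρ : B →ₐ[A] A) (hπ : Function.Surjective π) :
    letI P : Subalgebra A (A' × B) :=
      AlgHom.equalizer (π.comp (AlgHom.fst A A' B)) (ρ.comp (AlgHom.snd A A' B))
    Set.BijOn
      (fun K : Submodule P (P ⊗[A] M) =>
        (quotMap M ((AlgHom.fst A A' B).comp P.val) K,
         quotMap M ((AlgHom.snd A A' B).comp P.val) K))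
      (quotSet A M P)
      {KK : Submodule A' (A' ⊗[A] M) × Submodule B (B ⊗[A] M) |
        KK.1 ∈ quotSet A M A' ∧ KK.2 ∈ quotSet A M B ∧
        quotMap M π KK.1 = quotMap M ρ KK.2} := by
  have hρ : Function.Surjective ρ := fun a => ⟨algebraMap A B a, by simp⟩
  refine main_aux _ A' B _ _ π ρ hπ hρ ?_ ?_ ?_ ?_ ?_
  · intro a
    obtain ⟨b, hb⟩ := hρ (π a)
    exact ⟨⟨(a, b), hb.symm⟩, rfl⟩
  · intro b
    obtain ⟨a, ha⟩ := hπ (ρ b)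
    exact ⟨⟨(a, b), ha⟩, rfl⟩
  · intro x h1 h2
    exact Subtype.ext (Prod.ext h1 h2)
  · ext x
    exact x.2
  · intro a b h
    exact ⟨⟨(a, b), h⟩, rfl, rfl⟩
end

section
/- Let A₀ be a commutative ring, M an A₀-module, and let A₀[M] denote the square-zero extension A₀ ⊕ M with multiplication (a,m)(a',m') = (aa', am'+a'm). Let F₀ be an A₀-module with a surjection F₀ → G₀ of A₀-modules with kernel H₀, where G₀ is flat over A₀. Then the set of liftings of G₀ to a quotient of F₀ ⊗_{A₀} A₀[M] flat over A₀[M] reducing to G₀ is in natural bijection with Hom_{A₀}(H₀, G₀ ⊗_{A₀} M). -/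
open TensorProduct

theorem aux_decomp {R P Q : Type*} [CommRing R] [AddCommGroup P] [Module R P]
    [AddCommGroup Q] [Module R Q] {ι κ : Type*} [Fintype ι] [Fintype κ]
    (r : ι → P) (q : ι → Q) (b : ι → κ → R) (y : κ → Q) :
    ∑ i, r i ⊗ₜ[R] q i = ∑ j, (∑ i, b i j • r i) ⊗ₜ[R] y j
      + ∑ i, r i ⊗ₜ[R] (q i - ∑ j, b i j • y j) := by
  simp only [tmul_sub, tmul_sum, sum_tmul, Finset.sum_sub_distrib, smul_tmul]
  rw [Finset.sum_comm (s := (Finset.univ : Finset κ))]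
  abel

universe uA uM uQ
theorem aux_flat {A : Type uA} {M : Type uM} [CommRing A] [AddCommGroup M] [Module A M]
    [Module Aᵐᵒᵖ M] [IsCentralScalar A M]
    {Q : Type uQ} {G : Type*} [AddCommGroup Q] [Module (TrivSqZeroExt A M) Q]
    [AddCommGroup G] [Module A G] [Module.Flat A G]
    (π : Q →+ G) (hπ : Function.Surjective π)
    (hs : ∀ (r : TrivSqZeroExt A M) (q : Q), π (r • q) = r.fst • π q)
    (ha : ∀ q, π q = 0 → q ∈ (RingHom.ker (TrivSqZeroExt.fstHom A A M)) •
      (⊤ : Submodule (TrivSqZeroExt A M) Q))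
    (hb : ∀ (ι : Type (max uA uM uQ)) [Fintype ι] (m : ι → M) (y : ι → Q),
      ∑ i, (TrivSqZeroExt.inr (m i) : TrivSqZeroExt A M) • y i = 0 →
      ∑ i, m i ⊗ₜ[A] π (y i) = 0) :
    Module.Flat (TrivSqZeroExt A M) Q := by
  classical
  have hmem : ∀ r : TrivSqZeroExt A M, r ∈ RingHom.ker (TrivSqZeroExt.fstHom A A M) ↔
      r.fst = 0 := fun r => by simp [RingHom.mem_ker]
  set J : Ideal (TrivSqZeroExt A M) := RingHom.ker (TrivSqZeroExt.fstHom A A M) with hJ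
  rw [Module.Flat.iff_rTensor_injective']
  intro I
  rw [injective_iff_map_eq_zero]
  intro x hx
  have hx : TensorProduct.lid _ _ (LinearMap.rTensor Q I.subtype x) = 0 := by rw [hx, map_zero]
  -- Step 1: x comes from (I ⊓ J) ⊗ Q
  have h1 : x ∈ LinearMap.range (LinearMap.rTensor Q (Submodule.inclusion
      (inf_le_left : I ⊓ J ≤ I))) := by
    have key : ∀ (r : I), ∀ z ∈ J • (⊤ : Submodule (TrivSqZeroExt A M) Q),
        r ⊗ₜ[TrivSqZeroExt A M] z ∈ LinearMap.range (LinearMap.rTensor Q (Submodule.inclusion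
          (inf_le_left : I ⊓ J ≤ I))) := by
      intro r z hz
      refine Submodule.smul_induction_on hz ?_ ?_
      · intro j hj q _
        refine ⟨⟨j * r.1, I.mul_mem_left _ r.2, J.mul_mem_right _ hj⟩ ⊗ₜ q, ?_⟩
        rw [LinearMap.rTensor_tmul, ← smul_tmul]
        rfl
      · intro a b h h'
        rw [tmul_add]; exact add_mem h h'
    obtain ⟨S, rfl⟩ := TensorProduct.exists_finset x
    rw [← Finset.sum_coe_sort] at hx ⊢
    simp only [map_sum, LinearMap.rTensor_tmul, TensorProduct.lid_tmul, Submodule.subtype_apply] at hx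
    have hG : ∑ i : S, (i.1.1.1.fst) • π i.1.2 = 0 := by
      have := congrArg π hx
      simpa [map_sum, hs] using this
    obtain ⟨k, b, g, h1, h2⟩ := Module.Flat.isTrivialRelation_of_sum_smul_eq_zero hG
    choose y hy using fun j => hπ (g j)
    rw [aux_decomp (fun i : S => i.1.1) (fun i : S => i.1.2)
      (fun i j => (TrivSqZeroExt.inl (b i j) : TrivSqZeroExt A M)) y]
    refine add_mem (sum_mem fun j _ => ?_) (sum_mem fun i _ => key _ _ (ha _ ?_))
    · refine ⟨⟨(∑ i : S, (TrivSqZeroExt.inl (b i j) : TrivSqZeroExt A M) • i.1.1 : I).1,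
        Subtype.property _, ?_⟩ ⊗ₜ y j, ?_⟩
      · refine (hmem _).2 ?_
        have := h2 j
        simpa [TrivSqZeroExt.fst_sum, mul_comm] using this
      · rfl
    · rw [map_sub, map_sum, sub_eq_zero]
      simpa [hs, hy] using h1 i
  obtain ⟨x, rfl⟩ := h1
  -- Step 2: x = 0
  suffices x = 0 by rw [this, map_zero]
  have key : ∀ (r : ↥(I ⊓ J)), ∀ z ∈ J • (⊤ : Submodule (TrivSqZeroExt A M) Q),
        r ⊗ₜ[TrivSqZeroExt A M] z = 0 := by
    intro r z hz
    refine Submodule.smul_induction_on hz ?_ ?_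
    · intro j hj q _
      rw [← smul_tmul]
      have : j • r = 0 := by
        have h1 := (hmem _).1 hj
        have h2 := (hmem _).1 r.2.2
        ext <;> simp [h1, h2]
      rw [this, zero_tmul]
    · intro a b h h'
      rw [tmul_add, h, h', add_zero]
  obtain ⟨S, rfl⟩ := TensorProduct.exists_finset x
  rw [← Finset.sum_coe_sort] at hx ⊢
  simp only [map_sum, LinearMap.rTensor_tmul, TensorProduct.lid_tmul, Submodule.subtype_apply] at hx
  have hinr : ∀ i : ↥(I ⊓ J), i.1 = TrivSqZeroExt.inr i.1.snd := fun i => by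
    have h2 := (hmem _).1 i.2.2
    ext <;> simp [h2]
  have hG : ∑ i : S, i.1.1.1.snd ⊗ₜ[A] π i.1.2 = 0 := by
    apply hb
    rw [← hx]
    refine Finset.sum_congr rfl fun i _ => ?_
    rw [← hinr]
    rfl
  obtain ⟨k, b, g, h1, h2⟩ := vanishesTrivially_of_sum_tmul_eq_zero_of_rTensor_injective A
    (Module.Flat.rTensor_preserves_injective_linearMap _ (Submodule.subtype_injective _)) hG
  choose y hy using fun j => hπ (g j)
  rw [aux_decomp (fun i : S => i.1.1) (fun i : S => i.1.2)
      (fun i j => (TrivSqZeroExt.inl (b i j) : TrivSqZeroExt A M)) y]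
  rw [Finset.sum_eq_zero, Finset.sum_eq_zero, add_zero]
  · intro i _
    refine key _ _ (ha _ ?_)
    rw [map_sub, map_sum, sub_eq_zero]
    simpa [hs, hy] using h1 i
  · intro j _
    have : (∑ i : S, (TrivSqZeroExt.inl (b i j) : TrivSqZeroExt A M) • i.1.1 : ↥(I ⊓ J)) = 0 := by
      apply Subtype.ext
      rw [hinr (∑ i : S, (TrivSqZeroExt.inl (b i j) : TrivSqZeroExt A M) • i.1.1)]
      have h3 := h2 j
      have h4 : ∀ i : S, i.1.1.1.fst = 0 := fun i => (hmem _).1 i.1.1.2.2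
      rw [Finset.univ_eq_attach] at h3
      simp only [] at h3
      simp [TrivSqZeroExt.snd_sum, h4, h3]
    rw [this, zero_tmul]

section
variable {A : Type uA} {M : Type uM} [CommRing A] [AddCommGroup M] [Module A M]
    [Module Aᵐᵒᵖ M] [IsCentralScalar A M]
    {F G : Type*} [AddCommGroup F] [Module A F] [AddCommGroup G] [Module A G]

noncomputable def qred (A : Type uA) (M : Type uM) [CommRing A] [AddCommGroup M] [Module A M]
    [Module Aᵐᵒᵖ M] [IsCentralScalar A M] (F : Type*) [AddCommGroup F] [Module A F] :
    (TrivSqZeroExt A M ⊗[A] F) →ₗ[A] F :=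
  (TensorProduct.lid A F).toLinearMap.comp
        (TensorProduct.map (TrivSqZeroExt.fstHom A A M).toLinearMap
          (LinearMap.id : F →ₗ[A] F))

noncomputable def qsnd (M : Type uM) [AddCommGroup M] [Module A M]
    [Module Aᵐᵒᵖ M] [IsCentralScalar A M] (φ : F →ₗ[A] G) :
    (TrivSqZeroExt A M ⊗[A] F) →ₗ[A] M ⊗[A] G :=
  TensorProduct.map (TrivSqZeroExt.sndHom A M) φ

noncomputable def qinr (A : Type uA) (M : Type uM) [CommRing A] [AddCommGroup M] [Module A M]
    [Module Aᵐᵒᵖ M] [IsCentralScalar A M] (F : Type*) [AddCommGroup F] [Module A F] :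
    M ⊗[A] F →ₗ[A] TrivSqZeroExt A M ⊗[A] F :=
  TensorProduct.map (TrivSqZeroExt.inrHom A M) LinearMap.id

@[simp] theorem qred_tmul (r : TrivSqZeroExt A M) (x : F) :
    qred A M F (r ⊗ₜ x) = r.fst • x := rfl
@[simp] theorem qsnd_tmul (φ : F →ₗ[A] G) (r : TrivSqZeroExt A M) (x : F) :
    qsnd M φ (r ⊗ₜ x) = r.snd ⊗ₜ φ x := rfl
@[simp] theorem qinr_tmul (m : M) (x : F) :
    qinr A M F (m ⊗ₜ x) = TrivSqZeroExt.inr m ⊗ₜ x := rfl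

theorem qred_smul (r : TrivSqZeroExt A M) (e : TrivSqZeroExt A M ⊗[A] F) :
    qred A M F (r • e) = r.fst • qred A M F e := by
  induction e with
  | zero => simp
  | tmul s x => simp [TensorProduct.smul_tmul', mul_smul]
  | add a b ha hb => simp only [smul_add, map_add, ha, hb]

theorem qsnd_smul (φ : F →ₗ[A] G) (r : TrivSqZeroExt A M) (e : TrivSqZeroExt A M ⊗[A] F) :
    qsnd M φ (r • e) = r.fst • qsnd M φ e + r.snd ⊗ₜ φ (qred A M F e) := by
  induction e with
  | zero => simp
  | tmul s x =>
    simp [TensorProduct.smul_tmul', add_tmul, tmul_smul]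
  | add a b ha hb => simp only [smul_add, map_add, ha, hb, tmul_add]; abel

theorem q_decomp (e : TrivSqZeroExt A M ⊗[A] F) :
    e = 1 ⊗ₜ qred A M F e + qinr A M F (qsnd M (LinearMap.id) e) := by
  induction e with
  | zero => simp
  | tmul s x =>
    simp only [qred_tmul, qsnd_tmul, qinr_tmul, LinearMap.id_apply]
    rw [← smul_tmul, ← add_tmul]
    congr 1
    ext <;> simp
  | add a b ha hb =>
    conv_lhs => rw [ha, hb]
    simp only [map_add, tmul_add]; abel

theorem qred_qinr (y : M ⊗[A] F) : qred A M F (qinr A M F y) = 0 := by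
  induction y with
  | zero => simp
  | tmul s x => simp
  | add a b ha hb => simp [ha, hb]

theorem qsnd_qinr (φ : F →ₗ[A] G) (y : M ⊗[A] F) :
    qsnd M φ (qinr A M F y) = LinearMap.lTensor M φ y := by
  induction y with
  | zero => simp
  | tmul s x => simp
  | add a b ha hb => simp [ha, hb]

theorem q_surj (φ : F →ₗ[A] G) (hφ : Function.Surjective φ) (x : F) (z : M ⊗[A] G) :
    ∃ e, qred A M F e = x ∧ qsnd M φ e = z := by
  obtain ⟨y, rfl⟩ := LinearMap.lTensor_surjective M hφ z
  exact ⟨1 ⊗ₜ x + qinr A M F y, by simp [qred_qinr], by simp [qsnd_qinr]⟩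

/-- elements with vanishing reduction lie in the ideal times everything -/
theorem q_mem_ker_smul (e : TrivSqZeroExt A M ⊗[A] F) (he : qred A M F e = 0) :
    e ∈ (RingHom.ker (TrivSqZeroExt.fstHom A A M)) •
      (⊤ : Submodule (TrivSqZeroExt A M) (TrivSqZeroExt A M ⊗[A] F)) := by
  rw [q_decomp e, he, tmul_zero, zero_add]
  generalize qsnd M LinearMap.id e = y
  induction y with
  | zero => simp
  | tmul m x =>
    have : qinr A M F (m ⊗ₜ x) = (TrivSqZeroExt.inr m : TrivSqZeroExt A M) •
        ((1 : TrivSqZeroExt A M) ⊗ₜ[A] x) := by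
      simp [TensorProduct.smul_tmul']
    rw [this]
    exact Submodule.smul_mem_smul (by simp [RingHom.mem_ker]) trivial
  | add a b ha hb => rw [map_add]; exact add_mem ha hb

/-- elements vanishing under both projections lie in any admissible kernel -/
theorem q_mem (φ : F →ₗ[A] G) (hφ : Function.Surjective φ)
    (K : Submodule (TrivSqZeroExt A M) (TrivSqZeroExt A M ⊗[A] F))
    (hK : ∀ x, φ x = 0 → ∃ e ∈ K, qred A M F e = x)
    (e : TrivSqZeroExt A M ⊗[A] F) (he : qred A M F e = 0) (he2 : qsnd M φ e = 0) : e ∈ K := by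
  rw [q_decomp e, he, tmul_zero, zero_add] at he2 ⊢
  rw [qsnd_qinr] at he2
  generalize qsnd M LinearMap.id e = y at *
  obtain ⟨w, rfl⟩ := (lTensor_exact M (f := (LinearMap.ker φ).subtype) (g := φ)
    (LinearMap.exact_subtype_ker_map φ) hφ y).1 he2
  clear he2
  induction w with
  | zero => simp
  | tmul m x =>
    obtain ⟨e, heK, hex⟩ := hK x.1 x.2
    have : qinr A M F (LinearMap.lTensor M (LinearMap.ker φ).subtype (m ⊗ₜ x)) =
        (TrivSqZeroExt.inr m : TrivSqZeroExt A M) • e := by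
      rw [q_decomp ((TrivSqZeroExt.inr m : TrivSqZeroExt A M) • e), qred_smul, qsnd_smul, hex]
      simp
    rw [this]
    exact K.smul_mem _ heK
  | add a b ha hb => rw [map_add, map_add]; exact add_mem ha hb

noncomputable def qK (φ : F →ₗ[A] G) (f : LinearMap.ker φ →ₗ[A] M ⊗[A] G) :
    Submodule (TrivSqZeroExt A M) (TrivSqZeroExt A M ⊗[A] F) where
  carrier := {e | ∃ h : φ (qred A M F e) = 0, qsnd M φ e = f ⟨qred A M F e, h⟩}
  add_mem' := by
    rintro a b ⟨ha, ha'⟩ ⟨hb, hb'⟩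
    refine ⟨by simp [ha, hb], ?_⟩
    rw [map_add, ha', hb', ← map_add]
    congr 1
    ext
    simp
  zero_mem' := ⟨by simp, by
    rw [map_zero, eq_comm]
    convert map_zero f
    simp⟩
  smul_mem' := by
    rintro r a ⟨ha, ha'⟩
    refine ⟨by simp [qred_smul, ha], ?_⟩
    have h0 : r.snd ⊗ₜ[A] φ (qred A M F a) = 0 := by rw [ha, tmul_zero]
    rw [qsnd_smul, h0, add_zero, ha', ← map_smul]
    congr 1
    ext
    simp [qred_smul]

theorem mem_qK (φ : F →ₗ[A] G) (f : LinearMap.ker φ →ₗ[A] M ⊗[A] G) (e) :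
    e ∈ qK φ f ↔ ∃ h : φ (qred A M F e) = 0, qsnd M φ e = f ⟨qred A M F e, h⟩ := Iff.rfl

theorem qK_flat [Module.Flat A G] (φ : F →ₗ[A] G) (hφ : Function.Surjective φ)
    (f : LinearMap.ker φ →ₗ[A] M ⊗[A] G) :
    Module.Flat (TrivSqZeroExt A M) ((TrivSqZeroExt A M ⊗[A] F) ⧸ qK φ f) := by
  have hle : (qK φ f).toAddSubgroup ≤ (φ ∘ₗ qred A M F).toAddMonoidHom.ker := by
    rintro e ⟨h, -⟩
    exact h
  let π : ((TrivSqZeroExt A M ⊗[A] F) ⧸ qK φ f) →+ G :=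
    QuotientAddGroup.lift (qK φ f).toAddSubgroup (φ ∘ₗ qred A M F).toAddMonoidHom hle
  have hπ : ∀ e, π (Submodule.Quotient.mk e) = φ (qred A M F e) := fun e => rfl
  refine aux_flat π ?_ ?_ ?_ ?_
  · intro g
    obtain ⟨x, rfl⟩ := hφ g
    exact ⟨Submodule.Quotient.mk (1 ⊗ₜ x), by simp [hπ]⟩
  · intro r q
    obtain ⟨e, rfl⟩ := Submodule.Quotient.mk_surjective _ q
    rw [← Submodule.Quotient.mk_smul, hπ, hπ, qred_smul, map_smul]
  · intro q hq
    obtain ⟨e, rfl⟩ := Submodule.Quotient.mk_surjective _ q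
    rw [hπ] at hq
    obtain ⟨e', h1, h2⟩ := q_surj φ hφ (qred A M F e) (f ⟨_, hq⟩)
    have he' : e' ∈ qK φ f := ⟨by rw [h1, hq], by rw [h2]; congr 2; exact h1.symm⟩
    have h3 := q_mem_ker_smul (e - e') (by rw [map_sub, h1, sub_self])
    have h4 : (Submodule.Quotient.mk e : (TrivSqZeroExt A M ⊗[A] F) ⧸ qK φ f) =
        (qK φ f).mkQ (e - e') := by
      rw [map_sub, Submodule.mkQ_apply, Submodule.mkQ_apply,
        (Submodule.Quotient.mk_eq_zero _).2 he', sub_zero]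
    rw [h4]
    have h5 := Submodule.mem_map_of_mem (f := (qK φ f).mkQ) h3
    rw [Submodule.map_smul''] at h5
    exact Submodule.smul_mono le_rfl le_top h5
  · intro ι _ m y h
    choose e he using fun i => Submodule.Quotient.mk_surjective _ (y i)
    obtain rfl : (fun i => Submodule.Quotient.mk (e i)) = y := funext he
    have h : (qK φ f).mkQ (∑ i, (TrivSqZeroExt.inr (m i) : TrivSqZeroExt A M) • e i) = 0 := by
      rw [← h, map_sum]; rfl
    rw [Submodule.mkQ_apply, Submodule.Quotient.mk_eq_zero] at h
    obtain ⟨h1, h2⟩ := h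
    have h3 : qred A M F (∑ i, (TrivSqZeroExt.inr (m i) : TrivSqZeroExt A M) • e i) = 0 := by
      simp [qred_smul]
    have h4 : (⟨qred A M F (∑ i, (TrivSqZeroExt.inr (m i) : TrivSqZeroExt A M) • e i), h1⟩ :
      LinearMap.ker φ) = 0 := Subtype.ext h3
    rw [h4, map_zero] at h2
    simpa [qsnd_smul, hπ] using h2

theorem flat_uniq (φ : F →ₗ[A] G)
    (K : Submodule (TrivSqZeroExt A M) (TrivSqZeroExt A M ⊗[A] F))
    (hKf : Module.Flat (TrivSqZeroExt A M) ((TrivSqZeroExt A M ⊗[A] F) ⧸ K))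
    (hK : ∀ e ∈ K, φ (qred A M F e) = 0)
    (e : TrivSqZeroExt A M ⊗[A] F) (heK : e ∈ K) (he : qred A M F e = 0) : qsnd M φ e = 0 := by
  rw [q_decomp e, he, tmul_zero, zero_add] at heK ⊢
  rw [qsnd_qinr]
  generalize qsnd M LinearMap.id e = y at *
  obtain ⟨S, rfl⟩ := TensorProduct.exists_finset y
  rw [← Finset.sum_coe_sort] at heK ⊢
  have h0 : ∑ i : S, (TrivSqZeroExt.inr i.1.1 : TrivSqZeroExt A M) •
      K.mkQ ((1 : TrivSqZeroExt A M) ⊗ₜ[A] i.1.2) = 0 := by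
    have := (Submodule.Quotient.mk_eq_zero K).2 heK
    rw [← Submodule.mkQ_apply, map_sum, map_sum] at this
    rw [← this]
    refine Finset.sum_congr rfl fun i _ => ?_
    rw [← map_smul, TensorProduct.smul_tmul', qinr_tmul]
    simp
  obtain ⟨k, b, g, h1, h2⟩ := Module.Flat.isTrivialRelation_of_sum_smul_eq_zero h0
  choose y hy using fun j => Submodule.Quotient.mk_surjective _ (g j)
  rw [map_sum]
  simp only [LinearMap.lTensor_tmul]
  refine sum_tmul_eq_zero_of_vanishesTrivially A
    ⟨k, fun i j => (b i j).fst, fun j => φ (qred A M F (y j)), ?_, ?_⟩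
  · intro i
    have h3 : (1 : TrivSqZeroExt A M) ⊗ₜ[A] i.1.2 - ∑ j, b i j • y j ∈ K := by
      rw [← Submodule.Quotient.mk_eq_zero, ← Submodule.mkQ_apply, map_sub, map_sum, sub_eq_zero]
      refine (h1 i).trans (Finset.sum_congr rfl fun j _ => ?_)
      rw [← hy]; rfl
    have h4 := hK _ h3
    rw [map_sub, map_sub, sub_eq_zero] at h4
    simpa [qred_smul] using h4
  · intro j
    have := congrArg TrivSqZeroExt.snd (h2 j)
    simpa [TrivSqZeroExt.snd_sum] using this

theorem q_bij [Module.Flat A G] (φ : F →ₗ[A] G) (hφ : Function.Surjective φ) :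
    Nonempty ((LinearMap.ker φ →ₗ[A] M ⊗[A] G) ≃
      {K : Submodule (TrivSqZeroExt A M) (TrivSqZeroExt A M ⊗[A] F) //
          Module.Flat (TrivSqZeroExt A M) ((TrivSqZeroExt A M ⊗[A] F) ⧸ K) ∧
          Submodule.map (qred A M F) (K.restrictScalars A) = LinearMap.ker φ}) := by
  have hex : ∀ f : LinearMap.ker φ →ₗ[A] M ⊗[A] G, ∀ x : LinearMap.ker φ,
      ∃ e ∈ qK φ f, qred A M F e = x ∧ qsnd M φ e = f x := by
    intro f x
    obtain ⟨e, h1, h2⟩ := q_surj φ hφ x.1 (f x)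
    exact ⟨e, ⟨by rw [h1]; exact x.2, by rw [h2]; congr 2; exact Subtype.ext h1.symm⟩, h1, h2⟩
  refine ⟨Equiv.ofBijective (fun f => ⟨qK φ f, qK_flat φ hφ f, ?_⟩) ⟨?_, ?_⟩⟩
  · apply le_antisymm
    · rintro _ ⟨e, ⟨h, -⟩, rfl⟩
      exact h
    · intro x hx
      obtain ⟨e, h1, h2, -⟩ := hex f ⟨x, hx⟩
      exact ⟨e, h1, h2⟩
  · intro f g hfg
    have hfg : qK φ f = qK φ g := congrArg Subtype.val hfg
    ext1 x
    obtain ⟨e, h1, h2, h3⟩ := hex f x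
    rw [hfg] at h1
    obtain ⟨h4, h5⟩ := h1
    rw [← h3, h5]
    congr 1
    exact Subtype.ext h2
  · rintro ⟨K, hKf, hK⟩
    have hK1 : ∀ e ∈ K, φ (qred A M F e) = 0 := fun e he => by
      have : qred A M F e ∈ LinearMap.ker φ := hK ▸ ⟨e, he, rfl⟩
      exact this
    have hK2 : ∀ x, φ x = 0 → ∃ e ∈ K, qred A M F e = x := fun x hx => by
      have hx : x ∈ LinearMap.ker φ := hx
      rw [← hK] at hx
      exact hx
    have hu := flat_uniq φ K hKf hK1
    have hu' : ∀ e ∈ K, ∀ e' ∈ K, qred A M F e = qred A M F e' → qsnd M φ e = qsnd M φ e' := by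
      intro e he e' he' h
      have := hu (e - e') (sub_mem he he') (by rw [map_sub, h, sub_self])
      rwa [map_sub, sub_eq_zero] at this
    choose s hs hs' using fun x : LinearMap.ker φ => hK2 x.1 x.2
    let f : LinearMap.ker φ →ₗ[A] M ⊗[A] G :=
      { toFun := fun x => qsnd M φ (s x)
        map_add' := fun x y => by
          rw [← map_add]
          exact hu' _ (hs _) _ (add_mem (hs _) (hs _)) (by simp [hs'])
        map_smul' := fun a x => by
          rw [RingHom.id_apply, ← map_smul]
          exact hu' _ (hs _) _ ((K.restrictScalars A).smul_mem a (hs x)) (by simp [hs']) }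
    refine ⟨f, Subtype.ext ?_⟩
    ext e
    constructor
    · rintro ⟨h, h'⟩
      have := q_mem φ hφ K hK2 (e - s ⟨_, h⟩) (by rw [map_sub, hs', sub_self])
        (by rw [map_sub, h', sub_eq_zero]; rfl)
      simpa using add_mem this (hs ⟨_, h⟩)
    · intro he
      exact ⟨hK1 e he, hu' _ he _ (hs _) (hs' ⟨_, hK1 e he⟩).symm⟩
end

set_option synthInstance.maxHeartbeats 1000000 in
set_option maxHeartbeats 1000000 in
/-- Tangent-space computation for the Quot functor: let `A₀[M]` be the trivial square-zero
extension of `A₀` by `M`, and let `F₀ → G₀` be a surjection of `A₀`-modules with kernel `H₀`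
and with `G₀` flat.  The set of liftings of `G₀` to a quotient of `F₀ ⊗_{A₀} A₀[M]` flat over
`A₀[M]` reducing to `G₀` (encoded by kernels `K` whose reduction is `H₀`) is in natural
bijection with `Hom_{A₀}(H₀, G₀ ⊗_{A₀} M)`. -/
theorem stmt6 (A₀ : Type*) [CommRing A₀] (M : Type*) [AddCommGroup M] [Module A₀ M]
    [Module A₀ᵐᵒᵖ M] [IsCentralScalar A₀ M]
    (F₀ G₀ : Type*) [AddCommGroup F₀] [Module A₀ F₀] [AddCommGroup G₀] [Module A₀ G₀]
    (φ : F₀ →ₗ[A₀] G₀) (hφ : Function.Surjective φ) [Module.Flat A₀ G₀] :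
    letI R' := TrivSqZeroExt A₀ M
    letI red : (R' ⊗[A₀] F₀) →ₗ[A₀] F₀ :=
      (TensorProduct.lid A₀ F₀).toLinearMap.comp
        (TensorProduct.map (TrivSqZeroExt.fstHom A₀ A₀ M).toLinearMap
          (LinearMap.id : F₀ →ₗ[A₀] F₀))
    Nonempty
      ({K : Submodule R' (R' ⊗[A₀] F₀) //
          Module.Flat R' ((R' ⊗[A₀] F₀) ⧸ K) ∧
          Submodule.map red (K.restrictScalars A₀) = LinearMap.ker φ} ≃
        (LinearMap.ker φ →ₗ[A₀] G₀ ⊗[A₀] M)) := by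
  obtain ⟨e⟩ := q_bij (M := M) φ hφ
  exact ⟨e.symm.trans (LinearEquiv.congrRight (TensorProduct.comm A₀ M G₀)).toEquiv⟩
end

section
/- A surjective, locally finitely-presented monomorphism of schemes Y → S with S a Noetherian affine scheme has Y quasi-compact. -/
open AlgebraicGeometry CategoryTheory
open scoped Topology

/-- In a spectral-like space, constructible sets are open in the constructible topology. -/
lemma isOpen_constructibleTopology_of_isConstructible {X : Type*} [TopologicalSpace X]
    [CompactSpace X] {s : Set X} (hs : Topology.IsConstructible s) :
    IsOpen[constructibleTopology X] s := by
  have key : IsOpen[constructibleTopology X] s ∧ IsOpen[constructibleTopology X] sᶜ := by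
    induction hs using Topology.IsConstructible.empty_union_induction with
    | open_retrocompact U ho hc =>
      refine ⟨hc.isCompact.isOpen_constructibleTopology_of_isOpen ho, ?_⟩
      refine IsCompact.isOpen_constructibleTopology_of_isClosed ?_ ho.isClosed_compl
      simpa using hc.isCompact
    | union s _ t _ h1 h2 =>
      let _ := constructibleTopology X
      exact ⟨IsOpen.union h1.1 h2.1, by rw [Set.compl_union]; exact IsOpen.inter h1.2 h2.2⟩
    | compl s _ h => exact ⟨h.2, by simpa using h.1⟩
  exact key.1

/-- A surjective, locally finitely-presented monomorphism of schemes `Y → S` with `S` a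
Noetherian affine scheme has `Y` quasi-compact. -/
theorem stmt7 {Y S : AlgebraicGeometry.Scheme} (f : Y ⟶ S) [Mono f]
    [LocallyOfFinitePresentation f] [AlgebraicGeometry.Surjective f]
    [IsAffine S] [AlgebraicGeometry.IsNoetherian S] :
    CompactSpace Y := by
  have hinj : Function.Injective f := f.injective
  have hcon (i : Y.affineCover.I₀) :
      Topology.IsConstructible (Set.range (Y.affineCover.f i ≫ f)) := by
    have : QuasiCompact (Y.affineCover.f i ≫ f) :=
      (quasiCompact_iff_compactSpace _).mpr inferInstance
    rw [← Set.image_univ]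
    exact Scheme.Hom.isConstructible_image _ .univ
  have hcpt : CompactSpace (WithConstructibleTopology S) := inferInstance
  obtain ⟨t, ht⟩ := isCompact_univ (X := WithConstructibleTopology S) |>.elim_finite_subcover
    (fun i ↦ WithTopology.ofTopology ⁻¹' Set.range (Y.affineCover.f i ≫ f))
    (fun i ↦ WithConstructibleTopology.isOpen_iff.mpr
      (isOpen_constructibleTopology_of_isConstructible (hcon i)))
    (fun s _ ↦ by
      obtain ⟨y, hy⟩ := f.surjective s.ofTopology
      obtain ⟨x, hx⟩ := Y.affineCover.covers y
      exact Set.mem_iUnion.mpr ⟨_, x, by simp [hx, hy]⟩)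
  constructor
  have : (Set.univ : Set Y) = ⋃ i ∈ t, Set.range (Y.affineCover.f i) := by
    refine (Set.eq_univ_of_forall fun y ↦ ?_).symm
    obtain ⟨i, hi, x, hx⟩ := Set.mem_iUnion₂.mp (ht (Set.mem_univ (WithTopology.toTopology _ (f y))))
    refine Set.mem_iUnion₂.mpr ⟨i, hi, x, hinj ?_⟩
    simpa using hx
  rw [this]
  exact t.isCompact_biUnion fun i _ ↦ isCompact_range (Y.affineCover.f i).continuous
end
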